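/- Let p ≥ 2, let μ be the uniform probability measure on S^{p−1} (normalized (p−1)-dimensional Hausdorff measure), and let K ≥ 1. Draw K points w_1, …, w_K independently according to μ. Then for every γ* ∈ (0, π/2], with probability at least 1 − (p·v_p/v_{p−1})·(1/sin^{p−1}(γ*/4))·exp(−K·(2·v_{p−1}/(p·v_p))·sin^{p−1}(γ*/2)) with respect to the product measure μ^K, the covering radius of the symmetrized set {±w_1, …, ±w_K} is strictly less than γ*, i.e., every unit vector u ∈ S^{p−1} satisfies min over i of arccos|⟨w_i, u⟩| < γ*. -/

import Mathlib

open scoped RealInnerProductSpace ENNReal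
open MeasureTheory

noncomputable section

/-- `vball p` is the Lebesgue volume `v_p = π^(p/2) / Γ(p/2 + 1)` of the unit ball of
`ℝ^p`. -/
def vball (p : ℕ) : ℝ := Real.pi ^ ((p : ℝ) / 2) / Real.Gamma ((p : ℝ) / 2 + 1)

open Metric Set Module

lemma add_one_sub_div_sq_le {c R s : ℝ} (hR : 0 < R) (hcR : c ^ 2 + R ^ 2 = 1)
    (hs : 0 ≤ s) (hsR : s < R) :
    (s * c / R + (1 - s / R)) ^ 2 ≤ 1 - s ^ 2 := by
  obtain ⟨a, rfl⟩ : ∃ a, s = a * R := ⟨s / R, by field_simp⟩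
  have ha : 0 ≤ a := nonneg_of_mul_nonneg_left hs hR
  have ha1 : a < 1 := by nlinarith
  have hc1 : c ≤ 1 := by nlinarith
  have e1 : a * R * c / R = a * c := by field_simp
  have e2 : a * R / R = a := by field_simp
  rw [e1, e2]
  have : 0 ≤ a * (1 - c) * (1 - a) := by
    apply mul_nonneg (mul_nonneg ha _) <;> linarith
  have hR2 : R ^ 2 = 1 - c ^ 2 := by linarith
  rw [mul_pow, hR2]
  nlinarith

lemma vball_pos (n : ℕ) : 0 < vball n :=
  div_pos (Real.rpow_pos_of_pos Real.pi_pos _) (Real.Gamma_pos_of_pos (by positivity))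

lemma volume_ball_zero_eq_vball {E : Type*} [NormedAddCommGroup E] [InnerProductSpace ℝ E]
    [FiniteDimensional ℝ E] [Nontrivial E] [MeasurableSpace E] [BorelSpace E] {r : ℝ} (hr : 0 ≤ r) :
    volume (ball (0 : E) r) = ENNReal.ofReal (r ^ finrank ℝ E * vball (finrank ℝ E)) := by
  rw [InnerProductSpace.volume_ball, ENNReal.ofReal_mul (by positivity), ENNReal.ofReal_pow hr,
    vball, Real.sqrt_eq_rpow, ← Real.rpow_mul_natCast Real.pi_pos.le, one_div_mul_eq_div]

/-- The volume of the cone of height one over a Euclidean ball. -/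
lemma volume_cone {V : Type*} [NormedAddCommGroup V] [InnerProductSpace ℝ V]
    [FiniteDimensional ℝ V] [Nontrivial V] [MeasurableSpace V] [BorelSpace V] {R : ℝ} (hR : 0 < R) :
    (volume : Measure V).prod volume
        (regionBetween (fun _ : V => (0 : ℝ)) (fun y => 1 - ‖y‖ / R) (ball 0 R)) =
      ENNReal.ofReal (vball (finrank ℝ V) * R ^ finrank ℝ V / (finrank ℝ V + 1)) := by
  set n := finrank ℝ V
  have hmeas : MeasurableSet
      (regionBetween (fun _ : V => (0 : ℝ)) (fun y => 1 - ‖y‖ / R) (ball 0 R)) :=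
    measurableSet_regionBetween measurable_const (by fun_prop) measurableSet_ball
  rw [Measure.prod_apply_symm hmeas]
  have hslice : ∀ t : ℝ, volume ((fun y : V => (y, t)) ⁻¹'
      (regionBetween (fun _ : V => (0 : ℝ)) (fun y => 1 - ‖y‖ / R) (ball 0 R))) =
      (Ioc (0 : ℝ) 1).indicator
        (fun t => ENNReal.ofReal ((R * (1 - t)) ^ n * vball n)) t := by
    intro t
    by_cases ht : t ∈ Ioc (0 : ℝ) 1
    · rw [indicator_of_mem ht, ← volume_ball_zero_eq_vball (E := V)
        (mul_nonneg hR.le (by linarith [ht.2]))]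
      congr 1
      ext y
      simp only [regionBetween, mem_preimage, mem_ofPred_eq, mem_ball_zero_iff, mem_Ioo, ht.1,
        true_and]
      rw [lt_sub_comm, div_lt_iff₀ hR, mul_comm R]
      refine ⟨fun h => h.2, fun h => ⟨h.trans_le ?_, h⟩⟩
      nlinarith [ht.1]
    · rw [indicator_of_notMem ht]
      convert measure_empty (μ := (volume : Measure V))
      ext y
      simp only [regionBetween, mem_preimage, mem_ofPred_eq, mem_ball_zero_iff, mem_Ioo,
        mem_empty_iff_false, iff_false]
      rintro ⟨-, h0, h1⟩
      have : 0 ≤ ‖y‖ / R := by positivity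
      exact ht ⟨h0, by linarith⟩
  simp_rw [hslice]
  rw [lintegral_indicator measurableSet_Ioc, ← ofReal_integral_eq_lintegral_ofReal]
  · congr 1
    rw [← intervalIntegral.integral_of_le zero_le_one]
    simp_rw [mul_pow]
    rw [intervalIntegral.integral_mul_const, intervalIntegral.integral_const_mul,
      intervalIntegral.integral_comp_sub_left (fun x => x ^ n), integral_pow]
    simp
    ring
  · exact (Continuous.integrableOn_Icc (by fun_prop)).mono_set Ioc_subset_Icc_self
  · filter_upwards [ae_restrict_mem measurableSet_Ioc] with t ht
    have := (vball_pos n).le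
    have : 0 ≤ 1 - t := by linarith [ht.2]
    positivity

/-- A lower bound for the volume of a spherical sector, in explicit coordinates. -/
lemma le_volume_sector_prod {V : Type*} [NormedAddCommGroup V] [InnerProductSpace ℝ V]
    [FiniteDimensional ℝ V] [Nontrivial V] [MeasurableSpace V] [BorelSpace V] {c R : ℝ}
    (hR : 0 < R) (hc : 0 ≤ c) (hcR : c ^ 2 + R ^ 2 = 1) :
    ENNReal.ofReal (vball (finrank ℝ V) * R ^ finrank ℝ V / (finrank ℝ V + 1)) ≤
      volume {x : WithLp 2 (V × ℝ) | ‖x‖ ≤ 1 ∧ c * ‖x‖ < x.snd} := by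
  have hshear : (volume : Measure V).prod volume
      (regionBetween (fun y : V => ‖y‖ * c / R) (fun y => ‖y‖ * c / R + (1 - ‖y‖ / R)) (ball 0 R)) =
      ENNReal.ofReal (vball (finrank ℝ V) * R ^ finrank ℝ V / (finrank ℝ V + 1)) := by
    rw [← volume_cone hR,
      volume_regionBetween_eq_lintegral (by fun_prop) (by fun_prop) measurableSet_ball,
      volume_regionBetween_eq_lintegral (by fun_prop) (by fun_prop) measurableSet_ball]
    simp
  rw [← hshear, ← Measure.volume_eq_prod, ← (WithLp.volume_preserving_ofLp V ℝ).measure_preimage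
    (measurableSet_regionBetween (by fun_prop) (by fun_prop)
      measurableSet_ball).nullMeasurableSet]
  refine measure_mono fun x hx => ?_
  obtain ⟨hy, ht, ht'⟩ := hx
  simp only [mem_ball_zero_iff] at hy ht ht'
  change ‖x.fst‖ < R at hy
  change ‖x.fst‖ * c / R < x.snd at ht
  change x.snd < ‖x.fst‖ * c / R + (1 - ‖x.fst‖ / R) at ht'
  have hs := norm_nonneg x.fst
  have hsq := add_one_sub_div_sq_le hR hcR hs hy
  have hnorm : ‖x‖ ^ 2 = ‖x.fst‖ ^ 2 + x.snd ^ 2 := by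
    rw [WithLp.prod_norm_sq_eq_of_L2, Real.norm_eq_abs, sq_abs]
  have h0 : 0 ≤ ‖x.fst‖ * c / R := by positivity
  have ht0 : 0 < x.snd := h0.trans_lt ht
  refine ⟨?_, ?_⟩
  · have : x.snd ^ 2 ≤ (‖x.fst‖ * c / R + (1 - ‖x.fst‖ / R)) ^ 2 := by gcongr
    nlinarith [norm_nonneg x]
  · rw [div_lt_iff₀ hR] at ht
    have : (‖x.fst‖ * c) ^ 2 < (x.snd * R) ^ 2 := by gcongr
    refine lt_of_pow_lt_pow_left₀ 2 ht0.le ?_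
    rw [mul_pow, hnorm]
    nlinarith

lemma exists_linearIsometryEquiv_map_eq {E F : Type*} [NormedAddCommGroup E]
    [InnerProductSpace ℝ E] [FiniteDimensional ℝ E] [NormedAddCommGroup F]
    [InnerProductSpace ℝ F] [FiniteDimensional ℝ F] (h : finrank ℝ E = finrank ℝ F)
    {x : E} {y : F} (hxy : ‖x‖ = ‖y‖) : ∃ L : E ≃ₗᵢ[ℝ] F, L x = y := by
  let L₀ : E ≃ₗᵢ[ℝ] F := (stdOrthonormalBasis ℝ E).equiv (stdOrthonormalBasis ℝ F) (finCongr h)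
  refine ⟨L₀.trans (ℝ ∙ (L₀ x - y))ᗮ.reflection, ?_⟩
  exact Submodule.reflection_sub (by rw [L₀.norm_map, hxy])

section DoubleCap

variable {E : Type*} [NormedAddCommGroup E] [InnerProductSpace ℝ E]

/-- The pair of opposite open caps of the unit sphere with axis `u` and height parameter `c`. -/
def doubleCap (u : E) (c : ℝ) : Set E := {w | ‖w‖ = 1 ∧ c < |⟪w, u⟫|}

lemma preimage_doubleCap (L : E ≃ₗᵢ[ℝ] E) (u : E) (c : ℝ) :
    L ⁻¹' doubleCap (L u) c = doubleCap u c := by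
  ext w
  simp [doubleCap]

lemma measurableSet_doubleCap [MeasurableSpace E] [BorelSpace E] (u : E) (c : ℝ) :
    MeasurableSet (doubleCap u c) := by
  have heq : MeasurableSet {w : E | ‖w‖ = 1} :=
    (isClosed_eq (by fun_prop) (by fun_prop)).measurableSet
  have hlt : MeasurableSet {w : E | c < |⟪w, u⟫|} :=
    (isOpen_lt (by fun_prop) (by fun_prop)).measurableSet
  exact heq.inter hlt

end DoubleCap

section Sector

variable {E : Type*} [NormedAddCommGroup E] [InnerProductSpace ℝ E] [FiniteDimensional ℝ E]
  [MeasurableSpace E] [BorelSpace E]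

lemma le_volume_sector {n : ℕ} (hn : 1 ≤ n) (hE : finrank ℝ E = n + 1) {x : E} (hx : ‖x‖ = 1)
    {c R : ℝ} (hR : 0 < R) (hc : 0 ≤ c) (hcR : c ^ 2 + R ^ 2 = 1) :
    ENNReal.ofReal (vball n * R ^ n / (n + 1)) ≤
      volume {y : E | ‖y‖ ≤ 1 ∧ c * ‖y‖ < ⟪x, y⟫} := by
  let V := EuclideanSpace ℝ (Fin n)
  have : Nonempty (Fin n) := ⟨⟨0, hn⟩⟩
  have hV : finrank ℝ V = n := by simp [V]
  let e : WithLp 2 (V × ℝ) := WithLp.toLp 2 (0, 1)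
  obtain ⟨L, hL⟩ := exists_linearIsometryEquiv_map_eq (E := E) (F := WithLp 2 (V × ℝ)) (x := x)
    (y := e) (by
      rw [hE, LinearEquiv.finrank_eq (WithLp.linearEquiv 2 ℝ (V × ℝ)), Module.finrank_prod, hV,
        Module.finrank_self]) (by simp [hx, e])
  have hsec := le_volume_sector_prod (V := V) hR hc hcR
  rw [hV] at hsec
  refine hsec.trans_eq ?_
  rw [← L.measurePreserving.measure_preimage_equiv (f := L.toMeasurableEquiv)]
  congr 1
  ext y
  have : (L y).snd = ⟪x, y⟫ := by
    rw [← L.inner_map_map, hL]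
    simp [e, WithLp.prod_inner_apply]
  change ‖L y‖ ≤ 1 ∧ c * ‖L y‖ < (L y).snd ↔ _
  rw [this, L.norm_map]
  rfl

lemma le_volume_double_sector {n : ℕ} (hn : 1 ≤ n) (hE : finrank ℝ E = n + 1) {x : E}
    (hx : ‖x‖ = 1) {c R : ℝ} (hR : 0 < R) (hc : 0 ≤ c) (hcR : c ^ 2 + R ^ 2 = 1) :
    ENNReal.ofReal (2 * (vball n * R ^ n / (n + 1))) ≤
      volume {y : E | ‖y‖ ≤ 1 ∧ c * ‖y‖ < |⟪x, y⟫|} := by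
  have h1 := le_volume_sector hn hE hx hR hc hcR
  have h2 := le_volume_sector hn hE (x := -x) (by simpa using hx) hR hc hcR
  rw [two_mul, ENNReal.ofReal_add (by have := vball_pos n; positivity)
    (by have := vball_pos n; positivity)]
  refine (add_le_add h1 h2).trans ?_
  rw [← measure_union]
  · refine measure_mono ?_
    rintro y (⟨hy, h⟩ | ⟨hy, h⟩)
    · exact ⟨hy, h.trans_le (le_abs_self _)⟩
    · exact ⟨hy, h.trans_le (by rw [inner_neg_left]; exact neg_le_abs _)⟩
  · rw [Set.disjoint_left]
    rintro y ⟨-, h⟩ ⟨-, h'⟩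
    rw [inner_neg_left] at h'
    have : 0 ≤ c * ‖y‖ := by positivity
    linarith
  · have hle : MeasurableSet {y : E | ‖y‖ ≤ 1} := measurableSet_le (by fun_prop) (by fun_prop)
    have hlt : MeasurableSet {y : E | c * ‖y‖ < ⟪-x, y⟫} :=
      measurableSet_lt (by fun_prop) (by fun_prop)
    exact hle.inter hlt

/-- Two rotation-invariant measures are compared by integrating the indicator of a zonal relation
in both orders. -/
lemma measure_doubleCap_mul_volume_ball (μ : Measure E) [IsProbabilityMeasure μ]
    (hsphere : μ (sphere 0 1) = 1)
    (hinv : ∀ (L : E ≃ₗᵢ[ℝ] E) (A : Set E), MeasurableSet A → μ (L ⁻¹' A) = μ A)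
    {x u : E} (hx : ‖x‖ = 1) (hu : ‖u‖ = 1) (c : ℝ) :
    μ (doubleCap u c) * volume (ball (0 : E) 1) =
      volume {y : E | ‖y‖ ≤ 1 ∧ c * ‖y‖ < |⟪x, y⟫|} := by
  have : Nontrivial E := ⟨x, 0, by rintro rfl; simp at hx⟩
  set B := closedBall (0 : E) 1
  have hsphere' : ∀ᵐ w ∂μ, ‖w‖ = 1 := by
    have := (prob_compl_eq_zero_iff (μ := μ) isClosed_sphere.measurableSet).2 hsphere
    filter_upwards [measure_eq_zero_iff_ae_notMem.1 this] with w hw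
    simpa using hw
  let Z : Set (E × E) := {q | ‖q.1‖ = 1 ∧ c * ‖q.2‖ < |⟪q.1, q.2⟫|}
  have hZ : MeasurableSet Z := by
    have heq : MeasurableSet {q : E × E | ‖q.1‖ = 1} :=
      (isClosed_eq (by fun_prop) (by fun_prop)).measurableSet
    have hlt : MeasurableSet {q : E × E | c * ‖q.2‖ < |⟪q.1, q.2⟫|} :=
      (isOpen_lt (by fun_prop) (by fun_prop)).measurableSet
    exact heq.inter hlt
  have hfin : IsFiniteMeasure (volume.restrict B) :=
    ⟨by simpa using measure_closedBall_lt_top⟩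
  have hright : (μ.prod (volume.restrict B)) Z = μ (doubleCap u c) * volume (ball (0 : E) 1) := by
    rw [Measure.prod_apply_symm hZ]
    have : ∀ᵐ y ∂(volume.restrict B), μ ((fun w => (w, y)) ⁻¹' Z) = μ (doubleCap u c) := by
      have h0 : ∀ᵐ y ∂(volume.restrict B), y ≠ 0 := Measure.ae_ne _ _
      filter_upwards [h0] with y hy
      have hy' : 0 < ‖y‖ := norm_pos_iff.2 hy
      obtain ⟨L, hL⟩ := exists_linearIsometryEquiv_map_eq (E := E) (F := E) rfl
        (x := u) (y := ‖y‖⁻¹ • y)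
        (by rw [hu, norm_smul, norm_inv, norm_norm, inv_mul_cancel₀ hy'.ne'])
      rw [← preimage_doubleCap L, hinv L _ (measurableSet_doubleCap _ _), hL]
      congr 1
      ext w
      simp only [Z, doubleCap, mem_preimage, mem_ofPred_eq, inner_smul_right, abs_mul, abs_inv,
        abs_norm, and_congr_right_iff]
      intro _
      rw [lt_inv_mul_iff₀ hy', mul_comm]
    rw [lintegral_congr_ae this, lintegral_const, Measure.restrict_apply_univ,
      Measure.addHaar_closedBall_eq_addHaar_ball]
  rw [← hright, Measure.prod_apply hZ]
  have : ∀ᵐ w ∂μ, volume.restrict B (Prod.mk w ⁻¹' Z) =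
      volume {y : E | ‖y‖ ≤ 1 ∧ c * ‖y‖ < |⟪x, y⟫|} := by
    filter_upwards [hsphere'] with w hw
    obtain ⟨L, hL⟩ := exists_linearIsometryEquiv_map_eq (E := E) (F := E) rfl
      (x := x) (y := w) (by rw [hx, hw])
    rw [Measure.restrict_apply (measurable_prodMk_left hZ),
      ← L.measurePreserving.measure_preimage_equiv (f := L.toMeasurableEquiv)]
    congr 1
    ext y
    have : ⟪w, L y⟫ = ⟪x, y⟫ := by rw [← hL, L.inner_map_map]
    simp [Z, B, hw, this, and_comm]
  rw [lintegral_congr_ae this, lintegral_const, measure_univ, mul_one]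

lemma le_measureReal_doubleCap (μ : Measure E) [IsProbabilityMeasure μ]
    (hsphere : μ (sphere 0 1) = 1)
    (hinv : ∀ (L : E ≃ₗᵢ[ℝ] E) (A : Set E), MeasurableSet A → μ (L ⁻¹' A) = μ A)
    {p : ℕ} (hp : 2 ≤ p) (hE : finrank ℝ E = p) {u : E} (hu : ‖u‖ = 1) {r : ℝ} (hr : 0 < r)
    (hr' : r ≤ Real.pi / 2) :
    2 * vball (p - 1) / (p * vball p) * Real.sin r ^ (p - 1) ≤
      μ.real (doubleCap u (Real.cos r)) := by
  obtain ⟨n, rfl⟩ : ∃ n, p = n + 1 := ⟨p - 1, by omega⟩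
  have : Nontrivial E := ⟨u, 0, by rintro rfl; simp at hu⟩
  have hsin : 0 < Real.sin r := Real.sin_pos_of_pos_of_lt_pi hr (by linarith [Real.pi_pos])
  have hle := le_volume_double_sector (by omega) hE hu hsin
    (Real.cos_nonneg_of_mem_Icc ⟨by linarith, hr'⟩) (Real.cos_sq_add_sin_sq r)
  rw [← measure_doubleCap_mul_volume_ball μ hsphere hinv hu hu,
    volume_ball_zero_eq_vball zero_le_one, hE, one_pow, one_mul, ← ofReal_measureReal,
    ← ENNReal.ofReal_mul measureReal_nonneg, ENNReal.ofReal_le_ofReal_iff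
      (mul_nonneg measureReal_nonneg (vball_pos _).le)] at hle
  have hv := vball_pos (n + 1)
  rw [← div_le_iff₀ hv] at hle
  refine le_of_eq_of_le ?_ hle
  simp only [Nat.add_sub_cancel]
  push_cast
  field_simp

end Sector

lemma measureReal_pi_forall_notMem {Ω : Type*} [MeasurableSpace Ω] (μ : Measure Ω)
    [IsProbabilityMeasure μ] (K : ℕ) {A : Set Ω} (hA : MeasurableSet A) :
    (Measure.pi fun _ : Fin K => μ).real {w | ∀ i, w i ∉ A} = (1 - μ.real A) ^ K := by
  have : {w : Fin K → Ω | ∀ i, w i ∉ A} = Set.univ.pi fun _ => Aᶜ := by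
    ext w
    simp
  rw [this, measureReal_def, Measure.pi_pi, ENNReal.toReal_prod]
  simp [← measureReal_def, probReal_compl_eq_one_sub hA]

section Covering

variable {E : Type*} [NormedAddCommGroup E] [InnerProductSpace ℝ E]

lemma arccos_abs_inner_le_angle {x y : E} (hx : ‖x‖ = 1) (hy : ‖y‖ = 1) :
    Real.arccos |⟪x, y⟫| ≤ InnerProductGeometry.angle x y := by
  simpa [InnerProductGeometry.angle, hx, hy] using Real.arccos_le_arccos (le_abs_self ⟪x, y⟫)

lemma exists_angle_eq_arccos_abs_inner {x y : E} (hx : ‖x‖ = 1) (hy : ‖y‖ = 1) :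
    ∃ z, (z = y ∨ z = -y) ∧ InnerProductGeometry.angle x z = Real.arccos |⟪x, y⟫| := by
  rcases abs_choice ⟪x, y⟫ with h | h
  · exact ⟨y, .inl rfl, by simp [InnerProductGeometry.angle, hx, hy, h]⟩
  · exact ⟨-y, .inr rfl, by simp [InnerProductGeometry.angle, hx, hy, h]⟩

lemma arccos_abs_inner_triangle {x y z : E} (hx : ‖x‖ = 1) (hy : ‖y‖ = 1) (hz : ‖z‖ = 1) :
    Real.arccos |⟪x, z⟫| ≤ Real.arccos |⟪x, y⟫| + Real.arccos |⟪y, z⟫| := by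
  obtain ⟨x', hx', h₁⟩ := exists_angle_eq_arccos_abs_inner hy hx
  obtain ⟨z', hz', h₂⟩ := exists_angle_eq_arccos_abs_inner hy hz
  have habs : |⟪x', z'⟫| = |⟪x, z⟫| := by
    rcases hx' with rfl | rfl <;> rcases hz' with rfl | rfl <;> simp
  have hx1 : ‖x'‖ = 1 := by rcases hx' with rfl | rfl <;> simpa using hx
  have hz1 : ‖z'‖ = 1 := by rcases hz' with rfl | rfl <;> simpa using hz
  rw [← habs, real_inner_comm y x, ← h₁, ← h₂, InnerProductGeometry.angle_comm]
  exact (arccos_abs_inner_le_angle hx1 hz1).trans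
    (InnerProductGeometry.angle_le_angle_add_angle x' y z')

lemma mem_doubleCap_cos_iff {u w : E} (hu : ‖u‖ = 1) {r : ℝ} (hr : 0 ≤ r) (hr' : r ≤ Real.pi) :
    w ∈ doubleCap u (Real.cos r) ↔ ‖w‖ = 1 ∧ Real.arccos |⟪w, u⟫| < r := by
  refine and_congr_right fun hw => ?_
  have h1 : |⟪w, u⟫| ≤ 1 := by simpa [hw, hu] using abs_real_inner_le_norm w u
  constructor
  · intro h
    simpa [Real.arccos_cos hr hr'] using Real.arccos_lt_arccos (Real.neg_one_le_cos r) h h1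
  · intro h
    have := Real.cos_lt_cos_of_nonneg_of_le_pi (Real.arccos_nonneg _) hr' h
    rwa [Real.cos_arccos (by linarith [abs_nonneg ⟪w, u⟫]) h1] at this

variable [MeasurableSpace E] [BorelSpace E]

lemma card_mul_le_one_of_separated (μ : Measure E) [IsProbabilityMeasure μ] {r δ : ℝ} (hr : 0 ≤ r)
    (hr' : r ≤ Real.pi) (hcap : ∀ u : E, ‖u‖ = 1 → δ ≤ μ.real (doubleCap u (Real.cos r)))
    {T : Finset E} (hT : ∀ u ∈ T, ‖u‖ = 1)
    (hsep : (T : Set E).Pairwise fun u v => 2 * r ≤ Real.arccos |⟪u, v⟫|) :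
    T.card * δ ≤ 1 := by
  have hdisj : (T : Set E).PairwiseDisjoint fun u => doubleCap u (Real.cos r) := by
    intro u hu v hv huv
    refine Set.disjoint_left.2 fun w hwu hwv => ?_
    rw [mem_doubleCap_cos_iff (hT u hu) hr hr'] at hwu
    rw [mem_doubleCap_cos_iff (hT v hv) hr hr'] at hwv
    have h := arccos_abs_inner_triangle (hT u hu) hwu.1 (hT v hv)
    rw [real_inner_comm w u] at h
    linarith [hsep hu hv huv, hwu.2, hwv.2]
  calc (T.card : ℝ) * δ = ∑ _u ∈ T, δ := by simp
    _ ≤ ∑ u ∈ T, μ.real (doubleCap u (Real.cos r)) :=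
      Finset.sum_le_sum fun u hu => hcap u (hT u hu)
    _ = μ.real (⋃ u ∈ T, doubleCap u (Real.cos r)) :=
      (measureReal_biUnion_finset hdisj fun u _ => measurableSet_doubleCap u _).symm
    _ ≤ 1 := measureReal_le_one

lemma exists_finset_net (μ : Measure E) [IsProbabilityMeasure μ] {r δ : ℝ} (hr : 0 < r)
    (hr' : r ≤ Real.pi) (hδ : 0 < δ)
    (hcap : ∀ u : E, ‖u‖ = 1 → δ ≤ μ.real (doubleCap u (Real.cos r))) :
    ∃ T : Finset E, (∀ u ∈ T, ‖u‖ = 1) ∧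
      (∀ u : E, ‖u‖ = 1 → ∃ v ∈ T, Real.arccos |⟪u, v⟫| < 2 * r) ∧ T.card * δ ≤ 1 := by
  classical
  let N : Set ℕ := {n | ∃ T : Finset E, T.card = n ∧ (∀ u ∈ T, ‖u‖ = 1) ∧
    (T : Set E).Pairwise fun u v => 2 * r ≤ Real.arccos |⟪u, v⟫|}
  have hN : N.Nonempty := ⟨0, ∅, by simp⟩
  have hbdd : BddAbove N := by
    refine ⟨⌊1 / δ⌋₊, ?_⟩
    rintro _ ⟨T, rfl, hT, hsep⟩
    refine Nat.le_floor ?_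
    rw [le_div_iff₀ hδ]
    exact card_mul_le_one_of_separated μ hr.le hr' hcap hT hsep
  obtain ⟨T, hcard, hT, hsep⟩ := Nat.sSup_mem hN hbdd
  refine ⟨T, hT, fun u hu => ?_, card_mul_le_one_of_separated μ hr.le hr' hcap hT hsep⟩
  by_contra! hfar
  have huT : u ∉ T := fun h => by
    have := hfar u h
    rw [real_inner_self_eq_norm_sq, hu] at this
    simp at this
    linarith
  have hmem : T.card + 1 ∈ N := by
    refine ⟨insert u T, Finset.card_insert_of_notMem huT, ?_, ?_⟩
    · simpa [hu] using hT
    · rw [Finset.coe_insert]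
      refine hsep.insert fun v hv _ => ⟨hfar v hv, ?_⟩
      rw [real_inner_comm]
      exact hfar v hv
  have := le_csSup hbdd hmem
  omega

/-- The union bound over a net: a sample fails to be a `2 r`-net only if one of the caps of radius
`r` around the net points is missed. -/
lemma one_sub_card_mul_exp_le (μ : Measure E) [IsProbabilityMeasure μ] (K : ℕ)
    {r δ : ℝ} (hr : 0 ≤ r) (hr' : r ≤ Real.pi)
    (hcap : ∀ u : E, ‖u‖ = 1 → δ ≤ μ.real (doubleCap u (Real.cos r))) {T : Finset E}
    (hT : ∀ u ∈ T, ‖u‖ = 1)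
    (hnet : ∀ u : E, ‖u‖ = 1 → ∃ v ∈ T, Real.arccos |⟪u, v⟫| < r) :
    1 - T.card * Real.exp (-(K * δ)) ≤ (Measure.pi fun _ : Fin K => μ).real
      {w : Fin K → E | ∀ u : E, ‖u‖ = 1 → (⨅ i, Real.arccos |⟪w i, u⟫|) < 2 * r} := by
  set P := Measure.pi fun _ : Fin K => μ
  let bad (v : E) : Set (Fin K → E) := {w | ∀ i, w i ∉ doubleCap v (Real.cos r)}
  have hbad (v : E) : MeasurableSet (bad v) :=
    .congr (.iInter fun i => (measurableSet_doubleCap v (Real.cos r)).compl.preimage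
      (measurable_pi_apply i)) (by ext; simp [bad])
  have hunion : P.real (⋃ v ∈ T, bad v) ≤ T.card * Real.exp (-(K * δ)) := by
    calc P.real (⋃ v ∈ T, bad v) ≤ ∑ v ∈ T, P.real (bad v) := measureReal_biUnion_finset_le T bad
      _ ≤ ∑ v ∈ T, Real.exp (-(K * δ)) := by
        refine Finset.sum_le_sum fun v hv => ?_
        rw [measureReal_pi_forall_notMem μ K (measurableSet_doubleCap v _), ← mul_neg,
          Real.exp_nat_mul]
        have hle : μ.real (doubleCap v (Real.cos r)) ≤ 1 := measureReal_le_one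
        refine pow_le_pow_left₀ (by linarith) ?_ K
        linarith [hcap v (hT v hv), Real.add_one_le_exp (-δ)]
      _ = T.card * Real.exp (-(K * δ)) := by simp
  have hcompl : P.real (⋃ v ∈ T, bad v)ᶜ = 1 - P.real (⋃ v ∈ T, bad v) :=
    probReal_compl_eq_one_sub (T.measurableSet_biUnion fun v _ => hbad v)
  refine (sub_le_sub_left hunion 1).trans (hcompl.ge.trans (measureReal_mono ?_))
  intro w hw u hu
  obtain ⟨v, hv, huv⟩ := hnet u hu
  have : ∃ i, w i ∈ doubleCap v (Real.cos r) := by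
    by_contra! h
    exact hw (Set.mem_biUnion hv h)
  obtain ⟨i, hi⟩ := this
  rw [mem_doubleCap_cos_iff (hT v hv) hr hr'] at hi
  refine (ciInf_le (Set.finite_range _).bddBelow i).trans_lt ?_
  have h := arccos_abs_inner_triangle hi.1 (hT v hv) hu
  rw [real_inner_comm u v] at h
  linarith [hi.2]

end Covering

lemma hausdorffMeasure_sphere_invariant {E : Type*} [NormedAddCommGroup E] [InnerProductSpace ℝ E]
    [MeasurableSpace E] [BorelSpace E] (a : ℝ≥0∞) (d : ℝ) (L : E ≃ₗᵢ[ℝ] E) {A : Set E}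
    (hA : MeasurableSet A) :
    (a • (μH[d]).restrict (sphere (0 : E) 1)) (L ⁻¹' A) =
      (a • (μH[d]).restrict (sphere (0 : E) 1)) A := by
  have hL : L ⁻¹' A ∩ sphere 0 1 = L.toIsometryEquiv ⁻¹' (A ∩ sphere 0 1) := by
    ext x
    simp
  rw [Measure.smul_apply, Measure.smul_apply, Measure.restrict_apply hA,
    Measure.restrict_apply (L.continuous.measurable hA), hL,
    IsometryEquiv.hausdorffMeasure_preimage]

/-- Let `p ≥ 2`, let `μ` be the uniform probability measure on the unit
sphere `S^{p−1}` (the `(p−1)`-dimensional Hausdorff measure normalized to total mass one),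
and let `K ≥ 1`. If `K` points `w 0, …, w (K−1)` are drawn i.i.d. from `μ`, then with
probability (under the product measure) at least
`1 − (p·v_p/v_{p−1})·(1/sin^{p−1}(γ/4))·exp(−K·(2·v_{p−1}/(p·v_p))·sin^{p−1}(γ/2))`, the
covering radius of the symmetrized sample is `< γ`; i.e., every unit vector `u` satisfies
`min_i arccos |⟪w i, u⟫| < γ`. -/
theorem stmt_14 (p : ℕ) (hp : 2 ≤ p) (K : ℕ) (hK : 1 ≤ K)
    (μ : Measure (EuclideanSpace ℝ (Fin p))) [IsProbabilityMeasure μ]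
    (hμ : μ = (μH[(p : ℝ) - 1] (Metric.sphere (0 : EuclideanSpace ℝ (Fin p)) 1))⁻¹ •
        (μH[(p : ℝ) - 1]).restrict (Metric.sphere (0 : EuclideanSpace ℝ (Fin p)) 1))
    (γ : ℝ) (hγ : 0 < γ) (hγ' : γ ≤ Real.pi / 2) :
    1 - (p * vball p / vball (p - 1)) * (1 / Real.sin (γ / 4) ^ (p - 1)) *
        Real.exp (-(K * (2 * vball (p - 1) / (p * vball p)) * Real.sin (γ / 2) ^ (p - 1))) ≤
      ((Measure.pi fun _ : Fin K => μ)
        {w : Fin K → EuclideanSpace ℝ (Fin p) |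
          ∀ u : EuclideanSpace ℝ (Fin p), ‖u‖ = 1 →
            (⨅ i, Real.arccos |⟪w i, u⟫|) < γ}).toReal := by
  have hpi := Real.pi_pos
  have hE : finrank ℝ (EuclideanSpace ℝ (Fin p)) = p := by simp
  have hsphere : μ (sphere 0 1) = 1 := by
    rw [← prob_compl_eq_zero_iff isClosed_sphere.measurableSet, hμ, Measure.smul_apply,
      Measure.restrict_apply isClosed_sphere.measurableSet.compl]
    simp
  have hinv (L : EuclideanSpace ℝ (Fin p) ≃ₗᵢ[ℝ] EuclideanSpace ℝ (Fin p))
      (A : Set (EuclideanSpace ℝ (Fin p))) (hA : MeasurableSet A) : μ (L ⁻¹' A) = μ A := by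
    rw [hμ]
    exact hausdorffMeasure_sphere_invariant _ _ L hA
  have hv := vball_pos p
  have hv' := vball_pos (p - 1)
  have hp0 : (0 : ℝ) < p := by positivity
  have hsin : 0 < Real.sin (γ / 4) := Real.sin_pos_of_pos_of_lt_pi (by linarith) (by linarith)
  obtain ⟨T, hT, hnet, hcard⟩ := exists_finset_net μ (r := γ / 4)
    (δ := 2 * vball (p - 1) / (p * vball p) * Real.sin (γ / 4) ^ (p - 1)) (by linarith)
    (by linarith) (by positivity)
    fun u hu => le_measureReal_doubleCap μ hsphere hinv hp hE hu (by linarith) (by linarith)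
  rw [show 2 * (γ / 4) = γ / 2 by ring] at hnet
  have hmain := one_sub_card_mul_exp_le μ K (r := γ / 2)
    (δ := 2 * vball (p - 1) / (p * vball p) * Real.sin (γ / 2) ^ (p - 1)) (by linarith)
    (by linarith)
    (fun u hu => le_measureReal_doubleCap μ hsphere hinv hp hE hu (by linarith) (by linarith))
    hT hnet
  rw [show 2 * (γ / 2) = γ by ring, ← mul_assoc] at hmain
  refine le_trans ?_ hmain
  refine sub_le_sub_left (mul_le_mul_of_nonneg_right ?_ (Real.exp_nonneg _)) 1
  rw [← le_div_iff₀ (by positivity)] at hcard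
  refine hcard.trans ?_
  rw [div_le_iff₀ (by positivity)]
  field_simp
  norm_num
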